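/- arXiv:2507.04124 — 5 statements merged into one kernel-verified Lean document; each statement's English description precedes it below -/
import Mathlib

section
/- Let m ≥ 4 and let S̃_m be Schur's double cover of S_m, presented by generators z, t_1, …, t_{m−1} and relations z² = 1, z t_i = t_i z, t_i² = z, (t_i t_{i+1})³ = z for 1 ≤ i ≤ m−2, and (t_i t_j)² = z for |i − j| ≥ 2, with π : S̃_m → S_m the homomorphism sending z to 1 and t_i to the transposition (i, i+1). Then for every σ ∈ S_m and every x ∈ S̃_m with π(x) = σ, the elements x and z·x are NOT conjugate in S̃_m if and only if either (1) every part of the cycle partition of σ is odd, or (2) the parts of the cycle partition of σ are pairwise distinct and the number of even parts is odd. -/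
/-- The relations of Schur's double cover `S̃_m` of the symmetric group `S_m`:
generators `z = none` and `t_i = some i` (for `i : Fin (m - 1)`), with relations
`z² = 1`, `z t_i = t_i z`, `t_i² = z`, `(t_i t_{i+1})³ = z` for consecutive indices,
and `(t_i t_j)² = z` whenever `|i − j| ≥ 2`. -/
def schurRels (m : ℕ) : Set (FreeGroup (Option (Fin (m - 1)))) :=
  {w |
    w = (FreeGroup.of (none : Option (Fin (m - 1)))) ^ 2 ∨
    (∃ i : Fin (m - 1),
      w = FreeGroup.of (none : Option (Fin (m - 1))) * FreeGroup.of (some i) *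
        (FreeGroup.of (none : Option (Fin (m - 1))))⁻¹ * (FreeGroup.of (some i))⁻¹) ∨
    (∃ i : Fin (m - 1),
      w = (FreeGroup.of (some i)) ^ 2 * (FreeGroup.of (none : Option (Fin (m - 1))))⁻¹) ∨
    (∃ i j : Fin (m - 1), (j : ℕ) = (i : ℕ) + 1 ∧
      w = (FreeGroup.of (some i) * FreeGroup.of (some j)) ^ 3 *
        (FreeGroup.of (none : Option (Fin (m - 1))))⁻¹) ∨
    (∃ i j : Fin (m - 1), ((i : ℕ) + 2 ≤ (j : ℕ) ∨ (j : ℕ) + 2 ≤ (i : ℕ)) ∧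
      w = (FreeGroup.of (some i) * FreeGroup.of (some j)) ^ 2 *
        (FreeGroup.of (none : Option (Fin (m - 1))))⁻¹)}

/-- Schur's double cover `S̃_m`, as a presented group. -/
abbrev SchurCover (m : ℕ) : Type := PresentedGroup (schurRels m)


namespace SchurAux

open Equiv Equiv.Perm

lemma idx_lt {m : ℕ} (i : Fin (m - 1)) : (i : ℕ) < m := by
  have := i.2
  omega

lemma idx_succ_lt {m : ℕ} (i : Fin (m - 1)) : (i : ℕ) + 1 < m := by
  have := i.2
  omega

section Coxeter

variable {Q : Type*} [Group Q]

/-- `desc s j d = s (j+d) * ... * s j`. -/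
def desc (s : ℕ → Q) (j : ℕ) : ℕ → Q
  | 0 => s j
  | d + 1 => s (j + d + 1) * desc s j d

lemma desc_succ' (s : ℕ → Q) (j d : ℕ) : desc s j (d + 1) = desc s (j + 1) d * s j := by
  induction d with
  | zero => simp [desc]
  | succ d ih =>
    rw [desc, ih, desc, ← mul_assoc]
    congr 3
    omega

lemma desc_commute_low {s : ℕ → Q} {n : ℕ}
    (hfar : ∀ i j, i + 2 ≤ j → j < n → s i * s j = s j * s i)
    (i j d : ℕ) (hij : i + 2 ≤ j) (hn : j + d < n) :
    desc s j d * s i = s i * desc s j d := by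
  induction d with
  | zero => exact (hfar i j hij (by omega)).symm
  | succ d ih =>
    rw [desc, mul_assoc, ih (by omega), ← mul_assoc, ← hfar i (j + d + 1) (by omega) (by omega),
      mul_assoc]

lemma desc_commute_high {s : ℕ → Q} {n : ℕ}
    (hfar : ∀ i j, i + 2 ≤ j → j < n → s i * s j = s j * s i)
    (i j d : ℕ) (hij : j + d + 2 ≤ i) (hn : i < n) :
    desc s j d * s i = s i * desc s j d := by
  induction d with
  | zero => exact (hfar j i hij (by omega))
  | succ d ih =>
    rw [desc, mul_assoc, ih (by omega), ← mul_assoc, hfar (j + d + 1) i (by omega) (by omega),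
      mul_assoc]

lemma desc_braid {s : ℕ → Q} {n : ℕ}
    (hbr : ∀ i, i + 1 < n → s i * s (i + 1) * s i = s (i + 1) * s i * s (i + 1))
    (hfar : ∀ i j, i + 2 ≤ j → j < n → s i * s j = s j * s i)
    (i j d : ℕ) (hij : j ≤ i) (hid : i + 1 ≤ j + d) (hn : j + d < n) :
    desc s j d * s (i + 1) = s i * desc s j d := by
  induction d with
  | zero => omega
  | succ d ih =>
    by_cases h : i + 1 ≤ j + d
    · rw [desc, mul_assoc, ih h (by omega), ← mul_assoc,
        ← hfar i (j + d + 1) (by omega) (by omega), mul_assoc]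
    · obtain rfl : i = j + d := by omega
      cases d with
      | zero =>
        simp only [desc, add_zero]
        rw [← hbr j (by omega), mul_assoc]
      | succ d =>
        simp only [desc]
        have h1 := desc_commute_high hfar (j + (d + 1) + 1) j d (by omega) (by omega)
        have h2 := hbr (j + (d + 1)) (by omega)
        have e : j + d + 1 = j + (d + 1) := by omega
        rw [e, mul_assoc, mul_assoc, h1, ← mul_assoc, ← mul_assoc, ← h2]
        simp only [mul_assoc]

lemma coxeter_normal_form {s : ℕ → Q} {n : ℕ}
    (hsq : ∀ i, i < n → s i * s i = 1)
    (hbr : ∀ i, i + 1 < n → s i * s (i + 1) * s i = s (i + 1) * s i * s (i + 1))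
    (hfar : ∀ i j, i + 2 ≤ j → j < n → s i * s j = s j * s i)
    (k : ℕ) (hk : k < n) (g : Q) (hg : g ∈ Subgroup.closure (s '' {i | i < k + 1})) :
    ∃ h ∈ Subgroup.closure (s '' {i | i < k}), g = h ∨ ∃ j d, j + d = k ∧ g = h * desc s j d := by
  have key : ∀ (x : Q) (i : ℕ), i < k + 1 →
      (∃ h ∈ Subgroup.closure (s '' {i | i < k}),
        x = h ∨ ∃ j d, j + d = k ∧ x = h * desc s j d) →
      ∃ h ∈ Subgroup.closure (s '' {i | i < k}),
        x * s i = h ∨ ∃ j d, j + d = k ∧ x * s i = h * desc s j d := by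
    rintro x i hi ⟨h, hh, rfl | ⟨j, d, hjd, rfl⟩⟩
    · by_cases hik : i < k
      · exact ⟨x * s i, mul_mem hh (Subgroup.subset_closure ⟨i, hik, rfl⟩), Or.inl rfl⟩
      · obtain rfl : i = k := by omega
        exact ⟨x, hh, Or.inr ⟨i, 0, rfl, rfl⟩⟩
    · have mem : ∀ i, i < k → s i ∈ Subgroup.closure (s '' {i | i < k}) :=
        fun i hi => Subgroup.subset_closure ⟨i, hi, rfl⟩
      rcases lt_trichotomy i j with hij | rfl | hij
      · by_cases h1 : i + 1 = j
        · subst h1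
          exact ⟨h, hh, Or.inr ⟨i, d + 1, by omega, by rw [desc_succ', mul_assoc]⟩⟩
        · refine ⟨h * s i, mul_mem hh (mem i (by omega)), Or.inr ⟨j, d, hjd, ?_⟩⟩
          rw [mul_assoc, desc_commute_low hfar i j d (by omega) (by omega), mul_assoc]
      · cases d with
        | zero => exact ⟨h, hh, Or.inl (by simp [desc, mul_assoc, hsq i (by omega)])⟩
        | succ d =>
          refine ⟨h, hh, Or.inr ⟨i + 1, d, by omega, ?_⟩⟩
          rw [desc_succ', mul_assoc, mul_assoc, hsq i (by omega), mul_one]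
      · obtain ⟨i, rfl⟩ : ∃ l, i = l + 1 := ⟨i - 1, by omega⟩
        refine ⟨h * s i, mul_mem hh (mem i (by omega)), Or.inr ⟨j, d, hjd, ?_⟩⟩
        rw [mul_assoc, desc_braid hbr hfar i j d (by omega) (by omega) (by omega), mul_assoc]
  induction hg using Subgroup.closure_induction_right with
  | one => exact ⟨1, one_mem _, Or.inl rfl⟩
  | mul_right x hx y hy ih =>
    obtain ⟨i, hi, rfl⟩ := hy
    exact key x i hi ih
  | mul_inv_cancel x hx y hy ih =>
    obtain ⟨i, hi, rfl⟩ := hy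
    rw [inv_eq_of_mul_eq_one_left (hsq i (lt_of_lt_of_le hi hk))]
    exact key x i hi ih

lemma coxeter_injective {m n : ℕ} (hmn : n + 1 = m) {s : ℕ → Q}
    (hsq : ∀ i, i < n → s i * s i = 1)
    (hbr : ∀ i, i + 1 < n → s i * s (i + 1) * s i = s (i + 1) * s i * s (i + 1))
    (hfar : ∀ i j, i + 2 ≤ j → j < n → s i * s j = s j * s i)
    (p : Q →* Perm (Fin m))
    (hp : ∀ i (hi : i < n), p (s i) = swap ⟨i, by omega⟩ ⟨i + 1, by omega⟩)
    (k : ℕ) (hk : k ≤ n) (g : Q) (hg : g ∈ Subgroup.closure (s '' {i | i < k})) (h1 : p g = 1) :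
    g = 1 := by
  induction k generalizing g with
  | zero => simpa using hg
  | succ k ih =>
    have hfix : ∀ h ∈ Subgroup.closure (s '' {i | i < k}), ∀ hk' : k + 1 < m,
        p h ⟨k + 1, hk'⟩ = ⟨k + 1, hk'⟩ := by
      intro h hh hk'
      induction hh using Subgroup.closure_induction with
      | mem x hx =>
        obtain ⟨i, hi, rfl⟩ := hx
        simp only [Set.mem_ofPred_eq] at hi
        rw [hp i (by omega), swap_apply_of_ne_of_ne] <;> simp <;> omega
      | one => simp
      | mul x y _ _ hx hy => simp [hx, hy]
      | inv x _ hx => rw [map_inv, Perm.inv_eq_iff_eq, hx]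
    have hdesc : ∀ j d, j + d < n → ∀ (h1 : j < m) (h2 : j + d + 1 < m),
        p (desc s j d) ⟨j, h1⟩ = ⟨j + d + 1, h2⟩ := by
      intro j d hjd h1 h2
      induction d with
      | zero => simp [desc, hp j (by omega)]
      | succ d ih =>
        rw [desc, map_mul, Perm.mul_apply, ih (by omega) (by omega), hp _ (by omega)]
        simp; omega
    obtain ⟨h, hh, rfl | ⟨j, d, hjd, rfl⟩⟩ :=
      coxeter_normal_form hsq hbr hfar k (by omega) g hg
    · exact ih (by omega) _ hh h1
    · exfalso
      have h2 := hdesc j d (by omega) (by omega) (by omega)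
      have h3 := hfix h hh (by omega)
      have h4 := congrArg (fun f => f ⟨j, by omega⟩) h1
      simp only [map_mul, Perm.mul_apply, h2, Perm.one_apply] at h4
      subst hjd
      rw [h3] at h4
      simp at h4
      omega

end Coxeter
end SchurAux

namespace SchurAux
open Equiv Equiv.Perm

/-- Abstract double cover of `S_m`. -/
structure Cover {m : ℕ} {G : Type*} [Group G] (z : G) (p : G →* Perm (Fin m)) : Prop where
  zz : z * z = 1
  comm : ∀ x, z * x = x * z
  pz : p z = 1
  surj : Function.Surjective p
  ker : ∀ x, p x = 1 → x = 1 ∨ x = z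
  anti : ∀ x y a b c d, a ≠ b → c ≠ d → a ≠ c → a ≠ d → b ≠ c → b ≠ d →
    p x = swap a b → p y = swap c d → x * y = z * (y * x)

/-- The sign with which lifts of disjoint permutations commute. -/
def sg {G : Type*} [Group G] (z : G) (u v : ℤˣ) : G := if u = -1 ∧ v = -1 then z else 1

section
variable {m : ℕ} {G : Type*} [Group G] {z : G} {p : G →* Perm (Fin m)}

lemma sg_comm (u v : ℤˣ) : sg z u v = sg z v u := by
  simp [sg, and_comm]

lemma Cover.sg_mul (H : Cover z p) (u u' v : ℤˣ) : sg z (u * u') v = sg z u v * sg z u' v := by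
  rcases Int.units_eq_one_or u with rfl | rfl <;> rcases Int.units_eq_one_or u' with rfl | rfl <;>
  rcases Int.units_eq_one_or v with rfl | rfl <;> simp [sg, H.zz]

lemma Cover.sg_central (H : Cover z p) (u v : ℤˣ) (x : G) : sg z u v * x = x * sg z u v := by
  unfold sg; split_ifs
  · exact H.comm x
  · simp

lemma Cover.lift_eq (H : Cover z p) {x y : G} (h : p x = p y) : x = y ∨ x = z * y := by
  have := H.ker (x * y⁻¹) (by simp [h])
  rcases this with h | h
  · left; exact mul_inv_eq_one.mp h
  · right; exact mul_inv_eq_iff_eq_mul.mp h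

lemma Cover.disjoint_of_swap (H : Cover z p) (y : G)
    (hy : ∀ a b x, a ≠ b → p x = swap a b → Disjoint (swap a b) (p y) →
      x * y = sg z (-1) (sign (p y)) * (y * x)) (x : G) (hd : Disjoint (p x) (p y)) :
    x * y = sg z (sign (p x)) (sign (p y)) * (y * x) := by
  generalize hn : (p x).support.card = n
  induction n using Nat.strong_induction_on generalizing x with
  | _ n ih =>
  by_cases h1 : p x = 1
  · rcases H.ker x h1 with rfl | rfl
    · simp [sg]
    · rw [h1]; simp [sg, H.comm]
  · obtain ⟨a, ha⟩ : ∃ a, p x a ≠ a := by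
      by_contra! h
      exact h1 (Perm.ext h)
    obtain ⟨w, hw⟩ := H.surj (swap a (p x a))
    have hsup : ∀ c, c ∈ (p (w * x)).support → c ∈ (p x).support := by
      intro c hc
      rw [map_mul, hw] at hc
      exact (mem_support_swap_mul_imp_mem_support_ne hc).1
    have hd1 : Disjoint (p (w * x)) (p y) := by
      intro c
      rcases hd c with h | h
      · left; by_contra h'
        exact (mem_support.mp (hsup c (mem_support.mpr h'))) h
      · exact Or.inr h
    have hd2 : Disjoint (swap a (p x a)) (p y) := by
      intro c
      rcases hd c with h | h
      · left
        apply swap_apply_of_ne_of_ne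
        · rintro rfl; exact ha h
        · rintro rfl; exact ha ((p x).injective h)
      · exact Or.inr h
    have i1 := ih _ (by rw [← hn, map_mul, hw]; exact card_support_swap_mul ha) (w * x) hd1 rfl
    have i2 := hy a (p x a) w ha.symm hw hd2
    have hs : sign (p x) = (-1) * sign (p (w * x)) := by
      rw [map_mul, hw, Perm.sign_mul, sign_swap ha.symm]; simp
    have i3 : w⁻¹ * y = sg z (-1) (sign (p y)) * (y * w⁻¹) := by
      have hss : sg z (-1) (sign (p y)) * sg z (-1) (sign (p y)) = 1 := by
        rw [← H.sg_mul]; simp [sg]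
      rw [inv_mul_eq_iff_eq_mul, ← mul_assoc, ← H.sg_central, mul_assoc, ← mul_assoc w, i2]
      simp only [mul_assoc, mul_inv_cancel, mul_one]
      rw [← mul_assoc, hss, one_mul]
    rw [hs, H.sg_mul]
    calc x * y = w⁻¹ * ((w * x) * y) := by group
      _ = sg z (sign (p (w * x))) (sign (p y)) * ((w⁻¹ * y) * (w * x)) := by
        rw [i1, ← mul_assoc, ← H.sg_central]; simp only [mul_assoc]
      _ = _ := by
        rw [i3]
        have hc := H.sg_central (sign (p (w * x))) (sign (p y)) (sg z (-1) (sign (p y)))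
        rw [← hc]
        simp only [mul_assoc, inv_mul_cancel_left]

lemma Cover.disjoint (H : Cover z p) (x y : G) (hd : Disjoint (p x) (p y)) :
    x * y = sg z (sign (p x)) (sign (p y)) * (y * x) := by
  apply H.disjoint_of_swap y _ x hd
  intro a b x hab hx hd
  have symm' : ∀ u v (x y : G), x * y = sg z u v * (y * x) → y * x = sg z v u * (x * y) := by
    intro u v x y h
    rw [h, ← mul_assoc, sg_comm, ← H.sg_mul]
    rcases Int.units_eq_one_or v with rfl | rfl <;> simp [sg]
  have hsx : sign (p x) = -1 := by rw [hx, sign_swap hab]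
  rw [← hsx]
  apply symm'
  apply H.disjoint_of_swap x _ y (hx ▸ hd.symm)
  intro c d y hcd hy hd
  rw [hsx]
  have ha := hd a
  have hb := hd b
  rw [hx] at ha hb
  simp only [swap_apply_left, swap_apply_right, hab, hab.symm, or_false] at ha hb
  have ha' : a ≠ c ∧ a ≠ d := by
    constructor
    · rintro rfl; simp at ha; exact hcd ha.symm
    · rintro rfl; simp at ha; exact hcd ha
  have hb' : b ≠ c ∧ b ≠ d := by
    constructor
    · rintro rfl; simp at hb; exact hcd hb.symm
    · rintro rfl; simp at hb; exact hcd hb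
  simp only [sg, and_self, if_true]
  exact H.anti y x c d a b hcd hab ha'.1.symm hb'.1.symm ha'.2.symm hb'.2.symm hy hx

/-- all parts odd: not conjugate. -/
lemma Cover.not_conj_of_odd (H : Cover z p) (hz : z ≠ 1) (x : G) (hx : Odd (orderOf (p x)))
    (h : IsConj x (z * x)) : False := by
  obtain ⟨y, hy⟩ := isConj_iff.mp h
  set N := orderOf (p x)
  have hN : p (x ^ N) = 1 := by rw [map_pow]; exact pow_orderOf_eq_one _
  have h1 : y * x ^ N * y⁻¹ = z * x ^ N := by
    rw [← conj_pow, hy, (show Commute z x from H.comm x).mul_pow]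
    obtain ⟨k, hk⟩ := hx
    rw [hk, pow_succ z, pow_mul, pow_two, H.zz]; simp
  have h2 : y * x ^ N * y⁻¹ = x ^ N := by
    rcases H.ker _ hN with h | h
    · simp [h]
    · rw [h, ← H.comm]; simp
  rw [h2] at h1
  exact hz (by simpa using h1)

/-- the class with two orbits of equal length. -/
lemma Cover.conj_of_orbits (H : Cover z p) (x : G) (a b : Fin m) (k : ℕ) (hk : 0 < k)
    (ha : (p x ^ k) a = a) (hb : (p x ^ k) b = b)
    (haa : ∀ i, 0 < i → i < k → (p x ^ i) a ≠ a) (hbb : ∀ i, 0 < i → i < k → (p x ^ i) b ≠ b)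
    (hab : ∀ i : ℕ, (p x ^ i) a ≠ b) (hba : ∀ i : ℕ, (p x ^ i) b ≠ a)
    (hpar : Even k ∨ sign (p x) = -1) : IsConj x (z * x) := by
  obtain ⟨s, hs⟩ := H.surj (swap a b)
  have hne : a ≠ b := by simpa using hab 0
  let t : ℕ → G := fun i => x ^ i * s * (x ^ i)⁻¹
  have ht : ∀ i, p (t i) = swap ((p x ^ i) a) ((p x ^ i) b) := by
    intro i
    simp only [t, map_mul, map_inv, map_pow, hs]
    rw [Equiv.swap_apply_apply]
  have hts : ∀ i, x * t i = t (i + 1) * x := by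
    intro i; simp only [t, pow_succ']; group
  let y : ℕ → G := fun n => Nat.rec (motive := fun _ => G) 1 (fun i g => g * t (i + 1)) n
  have y0 : y 0 = 1 := rfl
  have ys : ∀ n, y (n + 1) = y n * t (n + 1) := fun n => rfl
  -- y n = t 1 ... t n
  have hy1 : ∀ n, x * (s * y n) = y n * t (n + 1) * x := by
    intro n
    induction n with
    | zero =>
      simp only [y0, t]
      group
    | succ n ih =>
      rw [ys, ← mul_assoc s, ← mul_assoc x, ih, mul_assoc (_ * _) x, hts, ← mul_assoc]
  have hy2 : ∀ n, n < k → y n * s = z ^ n * (s * y n) := by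
    intro n
    induction n with
    | zero => simp [y0]
    | succ n ih =>
      intro hn
      have h3 : t (n + 1) * s = z * (s * t (n + 1)) := by
        refine H.anti _ _ _ _ _ _ ?_ hne (haa _ (by omega) hn) (hab _) (hba _)
          (hbb _ (by omega) hn) (ht _) hs
        exact fun h => hne ((p x ^ (n + 1)).injective h)
      rw [ys, mul_assoc, h3, ← mul_assoc, ← H.comm, mul_assoc, ← mul_assoc (y n) s, ih (by omega),
        pow_succ']
      simp only [mul_assoc]
  obtain ⟨n, rfl⟩ : ∃ n, k = n + 1 := ⟨k - 1, by omega⟩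
  have hk1 : t (n + 1) = sg z (sign (p x) ^ (n + 1)) (-1) * s := by
    have hd : Disjoint (p (x ^ (n + 1))) (p s) := by
      intro c
      rw [hs, map_pow]
      by_cases hca : c = a
      · subst hca; exact Or.inl ha
      by_cases hcb : c = b
      · subst hcb; exact Or.inl hb
      exact Or.inr (swap_apply_of_ne_of_ne hca hcb)
    have := H.disjoint _ _ hd
    rw [hs, sign_swap hne, map_pow, map_pow] at this
    simp only [t]
    rw [this]; group
  have hfin : x * (s * y n) = z * ((s * y n) * x) := by
    rw [hy1, hk1, ← mul_assoc, ← H.sg_central, mul_assoc _ (y n), hy2 n (by omega)]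
    have : sg z (sign (p x) ^ (n + 1)) (-1) * z ^ n = z := by
      rcases Nat.even_or_odd n with he | ho
      · have h5 : sign (p x) = -1 := hpar.resolve_left (by
          rw [Nat.even_add_one]; simpa using he)
        rw [h5, (he.add_one).neg_one_pow]
        obtain ⟨r, rfl⟩ := he
        simp [sg, ← two_mul, pow_mul, pow_two, H.zz]
      · rw [show sign (p x) ^ (n + 1) = 1 from by
          rcases Int.units_eq_one_or (sign (p x)) with h | h
          · rw [h, one_pow]
          · rw [h, (ho.add_one).neg_one_pow]]
        obtain ⟨r, rfl⟩ := ho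
        simp [sg, pow_succ, pow_mul, pow_two z, H.zz]
    rw [← mul_assoc, this, mul_assoc]
  rw [isConj_iff]
  refine ⟨(s * y n)⁻¹, ?_⟩
  rw [mul_assoc, inv_inv, hfin, H.comm, ← mul_assoc, ← H.comm]
  group

lemma Cover.cycle_comm (H : Cover z p) (x y : G) (hc : p y ∈ (p x).cycleFactorsFinset) :
    y * x = sg z (sign (p y)) (sign (p x) * sign (p y)) * (x * y) := by
  have hd := disjoint_mul_inv_of_mem_cycleFactorsFinset hc
  have h := H.disjoint y (x * y⁻¹) (by simpa using hd.symm)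
  have hs : sign (p (x * y⁻¹)) = sign (p x) * sign (p y) := by simp
  rw [hs] at h
  have := congrArg (· * y) h
  simpa [mul_assoc] using this

lemma Cover.conj_of_even_cycle (H : Cover z p) (x : G) (c : Perm (Fin m))
    (hc : c ∈ (p x).cycleFactorsFinset) (hs : sign c = -1) (hx : sign (p x) = 1) :
    IsConj x (z * x) := by
  obtain ⟨y, rfl⟩ := H.surj c
  have h := H.cycle_comm x y hc
  rw [hs, hx] at h
  simp only [sg, one_mul, and_self, if_true] at h
  rw [isConj_iff]
  exact ⟨y, by rw [h]; group⟩

lemma Cover.not_conj_of_nodup (H : Cover z p) (hz : z ≠ 1) (x : G) (hx : sign (p x) = -1)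
    (hnd : (p x).cycleType.Nodup) (hfp : m ≤ (p x).support.card + 1)
    (h : IsConj x (z * x)) : False := by
  obtain ⟨y, hy⟩ := isConj_iff.mp h
  have hyc : y * x = z * x * y := by rw [← hy]; group
  have key : Subgroup.centralizer {p x} ≤ (Subgroup.centralizer {x}).map p := by
    rw [← OnCycleFactors.kerParam_range_eq_centralizer_of_count_le_one
      (Multiset.nodup_iff_count_le_one.mp hnd)]
    rintro _ ⟨⟨u, v⟩, rfl⟩
    have hu : u = 1 := by
      have hc : Fintype.card (Function.fixedPoints (p x)) ≤ 1 := by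
        rw [card_fixedPoints, sum_cycleType, Fintype.card_fin]; omega
      have : Subsingleton (Function.fixedPoints (p x)) := Fintype.card_le_one_iff_subsingleton.mp hc
      exact Subsingleton.elim _ _
    subst hu
    have : OnCycleFactors.kerParam (p x) (1, v) =
      Subgroup.noncommPiCoprod (p x).pairwise_commute_of_mem_zpowers v := by
      simp [OnCycleFactors.kerParam]
    rw [this]
    have h2 : Subgroup.noncommPiCoprod (p x).pairwise_commute_of_mem_zpowers v ∈
      (Subgroup.noncommPiCoprod (p x).pairwise_commute_of_mem_zpowers).range := ⟨v, rfl⟩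
    rw [Subgroup.noncommPiCoprod_range] at h2
    refine (show _ ≤ _ from iSup_le ?_ : (⨆ c : (p x).cycleFactorsFinset, Subgroup.zpowers c.val) ≤
      (Subgroup.centralizer {x}).map p) h2
    rintro ⟨c, hc⟩
    rw [Subgroup.zpowers_le]
    obtain ⟨w, rfl⟩ := H.surj c
    refine ⟨w, ?_, rfl⟩
    have h3 := H.cycle_comm x w hc
    rw [hx] at h3
    have h4 : sg z (sign (p w)) (-1 * sign (p w)) = 1 := by
      rcases Int.units_eq_one_or (sign (p w)) with h | h <;> simp [h, sg]
    rw [h4, one_mul] at h3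
    exact Subgroup.mem_centralizer_singleton_iff.mpr h3
  have hyc' : p y ∈ Subgroup.centralizer {p x} := by
    rw [Subgroup.mem_centralizer_singleton_iff, ← map_mul, hyc]
    simp [H.pz]
  obtain ⟨w, hw, hwy⟩ := key hyc'
  have hw' : w * x = x * w := Subgroup.mem_centralizer_singleton_iff.mp hw
  have : y * x = x * y := by
    rcases H.lift_eq hwy with rfl | rfl
    · exact hw'
    · have h5 : z * (y * x) = z * (x * y) := by
        rw [← mul_assoc, hw', ← mul_assoc, ← mul_assoc, H.comm x]
      exact mul_left_cancel h5
  rw [this, mul_assoc] at hyc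
  exact hz (by simpa using hyc)

end
section
variable {m : ℕ}

lemma even_filter_parts (σ : Perm (Fin m)) :
    σ.partition.parts.filter (fun p => Even p) = σ.cycleType.filter (fun p => Even p) := by
  rw [parts_partition, Multiset.filter_add]
  refine (congrArg _ (Multiset.filter_eq_nil.2 ?_)).trans (add_zero _)
  intro a ha
  rw [Multiset.eq_of_mem_replicate ha]
  decide

lemma neg_one_pow_multiset (s : Multiset ℕ) :
    (-1 : ℤˣ) ^ (s.sum + s.card) = (-1) ^ (s.filter (fun p => Even p)).card := by
  induction s using Multiset.induction_on with
  | empty => simp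
  | cons a s ih =>
    rw [Multiset.sum_cons, Multiset.card_cons,
      show a + s.sum + (s.card + 1) = (s.sum + s.card) + (a + 1) by ring, pow_add, ih]
    by_cases h : Even a
    · rw [Multiset.filter_cons_of_pos _ h, Multiset.card_cons, h.add_one.neg_one_pow,
        pow_succ]
    · rw [Multiset.filter_cons_of_neg _ h,
        (Nat.not_even_iff_odd.mp h).add_one.neg_one_pow, mul_one]

lemma sign_eq_parts (σ : Perm (Fin m)) :
    sign σ = (-1) ^ (σ.partition.parts.filter (fun p => Even p)).card := by
  rw [even_filter_parts, ← neg_one_pow_multiset, sign_of_cycleType]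

lemma odd_orderOf (σ : Perm (Fin m)) (h : ∀ p ∈ σ.partition.parts, Odd p) : Odd (orderOf σ) := by
  rw [← lcm_cycleType]
  have h' : ∀ p ∈ σ.cycleType, Odd p := fun p hp => h p (by rw [parts_partition]; simp [hp])
  generalize σ.cycleType = s at h'
  induction s using Multiset.induction_on with
  | empty => simp
  | cons a s ih =>
    rw [Multiset.lcm_cons]
    have h1 := h' a (by simp)
    have h2 := ih (fun p hp => h' p (by simp [hp]))
    exact Odd.of_dvd_nat (h1.mul h2) (lcm_dvd (dvd_mul_right _ _) (dvd_mul_left _ _))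

lemma nodup_parts_iff (σ : Perm (Fin m)) :
    σ.partition.parts.Nodup ↔ σ.cycleType.Nodup ∧ m ≤ σ.support.card + 1 := by
  rw [parts_partition, Multiset.nodup_add]
  rw [Multiset.nodup_iff_count_le_one (s := Multiset.replicate _ _)]
  have hd : _root_.Disjoint σ.cycleType
      (Multiset.replicate (Fintype.card (Fin m) - σ.support.card) 1) := by
    rw [Multiset.disjoint_left]
    intro a ha hb
    have := two_le_of_mem_cycleType ha
    rw [Multiset.eq_of_mem_replicate hb] at this
    omega
  rw [and_iff_left hd]
  simp only [Fintype.card_fin]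
  refine and_congr_right fun _ => ⟨fun h => ?_, fun h a => ?_⟩
  · have := h 1
    rw [Multiset.count_replicate_self] at this
    omega
  · rw [Multiset.count_replicate]
    split_ifs <;> omega

lemma exists_even_cycle (σ : Perm (Fin m)) (h : ¬ ∀ p ∈ σ.partition.parts, Odd p) :
    ∃ c ∈ σ.cycleFactorsFinset, sign c = -1 := by
  push Not at h
  obtain ⟨k, hk, hk2⟩ := h
  rw [Nat.not_odd_iff_even] at hk2
  have : k ∈ σ.partition.parts.filter (fun p => Even p) := Multiset.mem_filter.mpr ⟨hk, hk2⟩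
  rw [even_filter_parts, Multiset.mem_filter, cycleType_def, Multiset.mem_map] at this
  obtain ⟨⟨c, hc, rfl⟩, _⟩ := this
  refine ⟨c, hc, ?_⟩
  rw [(mem_cycleFactorsFinset_iff.mp hc).1.sign]
  have := hk2.neg_one_pow (α := ℤˣ)
  simp only [Function.comp_apply] at this
  rw [this]

lemma exists_orbits (σ : Perm (Fin m)) (h : ¬ σ.partition.parts.Nodup) :
    ∃ (a b : Fin m) (k : ℕ), 0 < k ∧ (σ ^ k) a = a ∧ (σ ^ k) b = b ∧
    (∀ i, 0 < i → i < k → (σ ^ i) a ≠ a) ∧ (∀ i, 0 < i → i < k → (σ ^ i) b ≠ b) ∧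
    (∀ i : ℕ, (σ ^ i) a ≠ b) ∧ (∀ i : ℕ, (σ ^ i) b ≠ a) := by
  rw [nodup_parts_iff, not_and_or] at h
  rcases h with h | h
  · rw [cycleType_def, Multiset.nodup_map_iff_inj_on σ.cycleFactorsFinset.nodup] at h
    push Not at h
    obtain ⟨c, hc, d, hd, hcd, hne⟩ := h
    rw [Finset.mem_val] at hc hd
    have hc' := mem_cycleFactorsFinset_iff.mp hc
    have hd' := mem_cycleFactorsFinset_iff.mp hd
    obtain ⟨a, ha⟩ := hc'.1.nonempty_support
    obtain ⟨b, hb⟩ := hd'.1.nonempty_support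
    have ea := cycle_is_cycleOf ha hc
    have eb := cycle_is_cycleOf hb hd
    have key : ∀ (c : Perm (Fin m)) (a : Fin m), c.IsCycle → a ∈ c.support → c = σ.cycleOf a →
        ∀ i : ℕ, (σ ^ i) a = a ↔ c.support.card ∣ i := by
      intro c a hc ha e i
      rw [← cycleOf_pow_apply_self, ← e, ← hc.pow_eq_one_iff' (mem_support.mp ha), ← hc.orderOf,
        orderOf_dvd_iff_pow_eq_one]
    have ka := key c a hc'.1 ha ea
    have kb := key d b hd'.1 hb eb
    simp only [Function.comp_apply] at hcd
    rw [← hcd] at kb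
    refine ⟨a, b, c.support.card, Finset.card_pos.mpr ⟨a, ha⟩, (ka _).2 dvd_rfl, (kb _).2 dvd_rfl,
      ?_, ?_, ?_, ?_⟩
    · intro i h1 h2 h3
      exact absurd (Nat.le_of_dvd h1 ((ka i).1 h3)) (by omega)
    · intro i h1 h2 h3
      exact absurd (Nat.le_of_dvd h1 ((kb i).1 h3)) (by omega)
    · intro i hi
      have : SameCycle σ a b := ⟨i, by simpa using hi⟩
      exact hne (by rw [ea, eb, this.cycleOf_eq])
    · intro i hi
      have : SameCycle σ b a := ⟨i, by simpa using hi⟩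
      exact hne (by rw [ea, eb, this.cycleOf_eq])
  · have hc : 1 < (σ.supportᶜ).card := by
      rw [Finset.card_compl, Fintype.card_fin]; omega
    obtain ⟨a, b, ha, hb, hab⟩ := Finset.one_lt_card_iff.mp hc
    simp only [Finset.mem_compl, notMem_support] at ha hb
    refine ⟨a, b, 1, one_pos, by simpa using ha, by simpa using hb, ?_, ?_, ?_, ?_⟩
    · intro i; omega
    · intro i; omega
    · intro i; rw [pow_apply_eq_self_of_apply_eq_self ha]; exact hab
    · intro i; rw [pow_apply_eq_self_of_apply_eq_self hb]; exact hab.symm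

theorem Cover.main {G : Type*} [Group G] {z : G} {p : G →* Perm (Fin m)} (H : Cover z p)
    (hz : z ≠ 1) (x : G) :
    ¬ IsConj x (z * x) ↔
      ((∀ q ∈ (p x).partition.parts, Odd q) ∨
        ((p x).partition.parts.Nodup ∧
          Odd (Multiset.card (Multiset.filter (fun q => Even q) (p x).partition.parts)))) := by
  have hsign := sign_eq_parts (p x)
  constructor
  · intro h
    by_contra hcon
    push Not at hcon
    obtain ⟨h1, h2⟩ := hcon
    apply h
    by_cases hodd : Odd (Multiset.card (Multiset.filter (fun q => Even q) (p x).partition.parts))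
    · rw [hodd.neg_one_pow] at hsign
      obtain ⟨a, b, k, hk, h3, h4, h5, h6, h7, h8⟩ := exists_orbits (p x) (fun hn => h2 hn hodd)
      exact H.conj_of_orbits x a b k hk h3 h4 h5 h6 h7 h8 (Or.inr hsign)
    · rw [(Nat.not_odd_iff_even.mp hodd).neg_one_pow] at hsign
      obtain ⟨c, hc, hs⟩ := exists_even_cycle (p x) (by push Not; exact h1)
      exact H.conj_of_even_cycle x c hc hs hsign
  · rintro (h | ⟨h1, h2⟩) hc
    · exact H.not_conj_of_odd hz x (odd_orderOf _ h) hc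
    · rw [h2.neg_one_pow] at hsign
      obtain ⟨h3, h4⟩ := (nodup_parts_iff _).mp h1
      exact H.not_conj_of_nodup hz x hsign h3 h4 hc

end
end SchurAux

namespace SchurAux
open Equiv Equiv.Perm

section Clifford

/-- The quadratic form `-(1/2) ∑ x_i²`. -/
noncomputable def qf (m : ℕ) : QuadraticForm ℚ (Fin m → ℚ) :=
  QuadraticMap.weightedSumSquares ℚ (fun _ : Fin m => (-1/2 : ℚ))

/-- The root `e_i - e_{i+1}`. -/
def root (m : ℕ) (i : Fin (m - 1)) : Fin m → ℚ :=
  Pi.single ⟨(i : ℕ), idx_lt i⟩ 1 - Pi.single ⟨(i : ℕ) + 1, idx_succ_lt i⟩ 1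

lemma qf_polar (m : ℕ) (v w : Fin m → ℚ) : QuadraticMap.polar (qf m) v w = - (v ⬝ᵥ w) := by
  simp only [QuadraticMap.polar, qf, QuadraticMap.weightedSumSquares_apply, dotProduct,
    ← Finset.sum_sub_distrib, ← Finset.sum_neg_distrib]
  refine Finset.sum_congr rfl fun i _ => ?_
  simp only [Pi.add_apply, smul_eq_mul]
  ring

lemma qf_eq (m : ℕ) (v : Fin m → ℚ) : qf m v = - (1/2) * (v ⬝ᵥ v) := by
  simp only [qf, QuadraticMap.weightedSumSquares_apply, dotProduct, Finset.mul_sum]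
  refine Finset.sum_congr rfl fun i _ => ?_
  simp only [smul_eq_mul]
  ring

/-- Image of the generator in the Clifford algebra. -/
noncomputable def cl (m : ℕ) (i : Fin (m - 1)) : CliffordAlgebra (qf m) :=
  CliffordAlgebra.ι (qf m) (root m i)

lemma root_dot (m : ℕ) (i j : Fin (m - 1)) : root m i ⬝ᵥ root m j =
    (if (i : ℕ) = j then 1 else 0) - (if (i : ℕ) = j + 1 then 1 else 0)
    - (if (i : ℕ) + 1 = j then 1 else 0) + (if (i : ℕ) = j then 1 else 0) := by
  simp only [root, sub_dotProduct, dotProduct_sub, single_dotProduct, Pi.single_apply, one_mul,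
    Fin.mk.injEq, add_left_inj]
  ring

lemma cl_sq (m : ℕ) (i : Fin (m - 1)) : cl m i * cl m i = -1 := by
  rw [cl, CliffordAlgebra.ι_sq_scalar, qf_eq, root_dot]
  simp only [if_true]
  rw [if_neg (by omega), if_neg (by omega), show (-(1/2) * (1 - 0 - 0 + 1) : ℚ) = -1 by norm_num]
  simp

lemma cl_comm (m : ℕ) (i j : Fin (m - 1)) : cl m i * cl m j + cl m j * cl m i =
    algebraMap ℚ _ (- (root m i ⬝ᵥ root m j)) := by
  rw [cl, cl, CliffordAlgebra.ι_mul_ι_add_swap, qf_polar]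

lemma cl_braid (m : ℕ) (i j : Fin (m - 1)) (h : (j : ℕ) = i + 1) : (cl m i * cl m j) ^ 3 = -1 := by
  have h1 := cl_comm m i j
  rw [root_dot] at h1
  have e1 : ¬ ((i : ℕ) = j) := by omega
  have e2 : ¬ ((i : ℕ) = j + 1) := by omega
  have e3 : ((i : ℕ) + 1 = j) := by omega
  simp only [e1, e2, e3, if_true, if_false] at h1
  simp at h1
  have ha := cl_sq m i
  have hb := cl_sq m j
  generalize cl m i = a at *
  generalize cl m j = b at *
  have h2 : b * a = 1 - a * b := eq_sub_of_add_eq' h1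
  have h3 : a * b * (a * b) = a * b - 1 := by
    calc a * b * (a * b) = a * (b * a) * b := by noncomm_ring
      _ = a * b - (a * a) * (b * b) := by rw [h2]; noncomm_ring
      _ = _ := by rw [ha, hb]; noncomm_ring
  rw [pow_succ, pow_two, h3, sub_mul, h3]
  noncomm_ring

lemma cl_far (m : ℕ) (i j : Fin (m - 1)) (h : (i : ℕ) + 2 ≤ j ∨ (j : ℕ) + 2 ≤ i) :
    (cl m i * cl m j) ^ 2 = -1 := by
  have h1 := cl_comm m i j
  rw [root_dot] at h1
  have e1 : ¬ ((i : ℕ) = j) := by omega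
  have e2 : ¬ ((i : ℕ) = j + 1) := by omega
  have e3 : ¬ ((i : ℕ) + 1 = j) := by omega
  simp only [e1, e2, e3, if_false] at h1
  simp at h1
  have ha := cl_sq m i
  have hb := cl_sq m j
  generalize cl m i = a at *
  generalize cl m j = b at *
  have h2 : b * a = - (a * b) := eq_neg_of_add_eq_zero_right h1
  calc (a * b) ^ 2 = a * (b * a) * b := by noncomm_ring
      _ = - ((a * a) * (b * b)) := by rw [h2]; noncomm_ring
      _ = _ := by rw [ha, hb]; noncomm_ring

/-- Unit version. -/
noncomputable def clu (m : ℕ) (i : Fin (m - 1)) : (CliffordAlgebra (qf m))ˣ where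
  val := cl m i
  inv := - cl m i
  val_inv := by rw [mul_neg, cl_sq, neg_neg]
  inv_val := by rw [neg_mul, cl_sq, neg_neg]

/-- The images of the generators. -/
noncomputable def genMap (m : ℕ) : Option (Fin (m - 1)) → (CliffordAlgebra (qf m))ˣ
  | none => -1
  | some i => clu m i

theorem z_ne_one (m : ℕ) :
    (PresentedGroup.of (none : Option (Fin (m - 1))) : SchurCover m) ≠ 1 := by
  have hrel : ∀ r ∈ schurRels m, FreeGroup.lift (genMap m) r = 1 := by
    rintro r (rfl | ⟨i, rfl⟩ | ⟨i, rfl⟩ | ⟨i, j, h, rfl⟩ | ⟨i, j, h, rfl⟩) <;>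
    simp only [map_mul, map_pow, map_inv, FreeGroup.lift_apply_of, genMap]
    · simp
    · simp
    · rw [mul_inv_eq_one]; ext; simp [clu, pow_two, cl_sq]
    · rw [mul_inv_eq_one]; ext; simp [clu, cl_braid m i j h]
    · rw [mul_inv_eq_one]; ext; simp [clu, cl_far m i j h]
  intro h
  have h2 := congrArg (PresentedGroup.toGroup hrel) h
  rw [PresentedGroup.toGroup.of, map_one] at h2
  have h3 := congrArg Units.val h2
  simp only [genMap, Units.val_neg, Units.val_one] at h3
  have : Nontrivial (CliffordAlgebra (qf m)) := inferInstance
  have : CharZero (CliffordAlgebra (qf m)) := algebraRat.charZero _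
  have h4 : (2 : CliffordAlgebra (qf m)) = 0 := by
    have h5 := congrArg (fun a => 1 + a) h3
    simp only [add_neg_cancel] at h5
    rw [h5]; norm_num
  exact two_ne_zero h4

end Clifford
end SchurAux

namespace SchurAux
open Equiv Equiv.Perm

section Final

variable {m : ℕ}

/-- The central element. -/
abbrev zz (m : ℕ) : SchurCover m := PresentedGroup.of (none : Option (Fin (m - 1)))

/-- The generators. -/
abbrev tt {m : ℕ} (i : Fin (m - 1)) : SchurCover m := PresentedGroup.of (some i)

lemma zz_sq : zz m * zz m = 1 := by
  have h := PresentedGroup.one_of_mem (rels := schurRels m) (Or.inl rfl)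
  rw [map_pow, pow_two] at h
  exact h

lemma zz_tt (i : Fin (m - 1)) : zz m * tt i = tt i * zz m := by
  have h := PresentedGroup.one_of_mem (rels := schurRels m) (Or.inr (Or.inl ⟨i, rfl⟩))
  simp only [map_mul, map_inv] at h
  rw [mul_inv_eq_one, mul_inv_eq_iff_eq_mul] at h
  exact h

lemma tt_sq (i : Fin (m - 1)) : tt i * tt i = zz m := by
  have h := PresentedGroup.one_of_mem (rels := schurRels m) (Or.inr (Or.inr (Or.inl ⟨i, rfl⟩)))
  simp only [map_mul, map_inv, map_pow] at h
  rw [mul_inv_eq_one, pow_two] at h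
  exact h

lemma tt_braid (i j : Fin (m - 1)) (hij : (j : ℕ) = i + 1) : (tt i * tt j) ^ 3 = zz m := by
  have h := PresentedGroup.one_of_mem (rels := schurRels m)
    (Or.inr (Or.inr (Or.inr (Or.inl ⟨i, j, hij, rfl⟩))))
  simp only [map_mul, map_inv, map_pow] at h
  rw [mul_inv_eq_one] at h
  exact h

lemma tt_far (i j : Fin (m - 1)) (hij : (i : ℕ) + 2 ≤ j ∨ (j : ℕ) + 2 ≤ i) :
    (tt i * tt j) ^ 2 = zz m := by
  have h := PresentedGroup.one_of_mem (rels := schurRels m)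
    (Or.inr (Or.inr (Or.inr (Or.inr ⟨i, j, hij, rfl⟩))))
  simp only [map_mul, map_inv, map_pow] at h
  rw [mul_inv_eq_one] at h
  exact h

lemma zz_comm (x : SchurCover m) : zz m * x = x * zz m := by
  have h : x ∈ Subgroup.centralizer {zz m} := by
    apply PresentedGroup.generated_by
    rintro (_ | i) <;> rw [Subgroup.mem_centralizer_singleton_iff]
    exact (zz_tt i).symm
  exact (Subgroup.mem_centralizer_singleton_iff.mp h).symm

lemma tt_anti (i j : Fin (m - 1)) (hij : (i : ℕ) + 2 ≤ j ∨ (j : ℕ) + 2 ≤ i) :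
    tt i * tt j = zz m * (tt j * tt i) := by
  have h := tt_far i j hij
  have h1 : (tt i * tt j) * (tt i * tt j) * (tt j * tt i) = zz m * (tt j * tt i) := by
    rw [← h, pow_two]
  rw [← h1]
  have h2 : tt j * (tt j * tt i) = zz m * tt i := by rw [← mul_assoc, tt_sq]
  have h3 : tt i * (tt j * (tt j * tt i)) = 1 := by
    rw [h2, zz_tt, ← mul_assoc, tt_sq, zz_sq]
  rw [mul_assoc, mul_assoc (tt i) (tt j) (tt j * tt i), h3, mul_one]

lemma ker_pi (π : SchurCover m →* Perm (Fin m)) (hm : 4 ≤ m)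
    (hπz : π (zz m) = 1)
    (hπt : ∀ i : Fin (m - 1),
      π (tt i) = swap ⟨(i : ℕ), idx_lt i⟩ ⟨(i : ℕ) + 1, idx_succ_lt i⟩)
    (x : SchurCover m) (hx : π x = 1) : x = 1 ∨ x = zz m := by
  let N : Subgroup (SchurCover m) := Subgroup.zpowers (zz m)
  have hzN : zz m ∈ N := Subgroup.mem_zpowers _
  have hN : N.Normal := ⟨by
    rintro n ⟨k, rfl⟩ g
    have : Commute (zz m) g := zz_comm g
    refine ⟨k, ?_⟩
    change zz m ^ k = g * zz m ^ k * g⁻¹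
    rw [← (this.zpow_left k).eq]; group⟩
  let q : SchurCover m →* SchurCover m ⧸ N := QuotientGroup.mk' N
  have hqz : q (zz m) = 1 := (QuotientGroup.eq_one_iff _).mpr hzN
  let s : ℕ → SchurCover m ⧸ N := fun i => if h : i < m - 1 then q (tt ⟨i, h⟩) else 1
  have hs : ∀ i (h : i < m - 1), s i = q (tt ⟨i, h⟩) := fun i h => by simp [s, h]
  have hNk : N ≤ π.ker := by
    rw [Subgroup.zpowers_le]; exact hπz
  let p : SchurCover m ⧸ N →* Perm (Fin m) := QuotientGroup.lift N π hNk
  have hpq : ∀ g, p (q g) = π g := fun g => rfl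
  have hsq : ∀ i, i < m - 1 → s i * s i = 1 := by
    intro i hi
    rw [hs i hi, ← map_mul, tt_sq, hqz]
  have hbr : ∀ i, i + 1 < m - 1 → s i * s (i + 1) * s i = s (i + 1) * s i * s (i + 1) := by
    intro i hi
    have h1 := hsq i (by omega)
    have h2 := hsq (i + 1) hi
    have h3 : (s i * s (i + 1)) ^ 3 = 1 := by
      rw [hs i (by omega), hs (i + 1) hi, ← map_mul, ← map_pow, tt_braid _ _ rfl, hqz]
    generalize s i = a at *
    generalize s (i + 1) = b at *
    have h1' : a⁻¹ = a := inv_eq_of_mul_eq_one_left h1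
    have h2' : b⁻¹ = b := inv_eq_of_mul_eq_one_left h2
    have h4 : (a * b * a) * (b * a * b) = 1 := by rw [← h3]; simp only [pow_succ, pow_zero, one_mul, mul_assoc]
    rw [mul_eq_one_iff_eq_inv.mp h4]
    simp [h1', h2', mul_assoc]
  have hfar : ∀ i j, i + 2 ≤ j → j < m - 1 → s i * s j = s j * s i := by
    intro i j hij hj
    rw [hs i (by omega), hs j hj, ← map_mul, tt_anti _ _ (Or.inl hij), map_mul, hqz, one_mul,
      map_mul]
  have hgen : q x ∈ Subgroup.closure (s '' {i | i < m - 1}) := by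
    change x ∈ (Subgroup.closure (s '' {i | i < m - 1})).comap q
    apply PresentedGroup.generated_by
    rintro (_ | i)
    · exact Subgroup.mem_comap.mpr (by rw [hqz]; exact one_mem _)
    · exact Subgroup.subset_closure ⟨i, i.2, hs i i.2⟩
  have h1 : q x = 1 := coxeter_injective (by omega) hsq hbr hfar p
    (fun i hi => by rw [hs i hi, hpq, hπt]) (m - 1) le_rfl (q x) hgen (by rw [hpq, hx])
  obtain ⟨k, hk⟩ := (QuotientGroup.eq_one_iff x).mp h1
  simp only at hk
  rcases Int.even_or_odd' k with ⟨r, rfl | rfl⟩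
  · left
    rw [← hk, zpow_mul, zpow_two, zz_sq, one_zpow]
  · right
    rw [← hk, zpow_add, zpow_mul, zpow_two, zz_sq, one_zpow, one_mul, zpow_one]

lemma surj_pi (π : SchurCover m →* Perm (Fin m)) (hm : 4 ≤ m)
    (hπt : ∀ i : Fin (m - 1),
      π (tt i) = swap ⟨(i : ℕ), idx_lt i⟩ ⟨(i : ℕ) + 1, idx_succ_lt i⟩) :
    Function.Surjective π := by
  obtain ⟨n, rfl⟩ : ∃ n, m = n + 1 := ⟨m - 1, by omega⟩
  rw [← MonoidHom.mrange_eq_top, eq_top_iff, ← mclosure_swap_castSucc_succ n,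
    Submonoid.closure_le]
  rintro _ ⟨i, rfl⟩
  exact ⟨tt (m := n + 1) i, hπt i⟩

lemma schurCover_cover (π : SchurCover m →* Perm (Fin m)) (hm : 4 ≤ m)
    (hπz : π (zz m) = 1)
    (hπt : ∀ i : Fin (m - 1),
      π (tt i) = swap ⟨(i : ℕ), idx_lt i⟩ ⟨(i : ℕ) + 1, idx_succ_lt i⟩) :
    Cover (zz m) π where
  zz := zz_sq
  comm := zz_comm
  pz := hπz
  surj := surj_pi π hm hπt
  ker := ker_pi π hm hπz hπt
  anti := by
    intro x y a b c d hab hcd hac had hbc hbd hx hy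
    obtain ⟨g, hg⟩ := Equiv.Perm.exists_extending_pair
      (![⟨0, by omega⟩, ⟨1, by omega⟩, ⟨2, by omega⟩, ⟨3, by omega⟩] : Fin 4 → Fin m)
      (![a, b, c, d] : Fin 4 → Fin m)
      (by
        intro i j hij
        fin_cases i <;> fin_cases j <;> simp at hij ⊢)
      (by
        intro i j hij
        fin_cases i <;> fin_cases j <;> simp_all [eq_comm])
    have g0 : g ⟨0, by omega⟩ = a := by simpa using hg 0
    have g1 : g ⟨1, by omega⟩ = b := by simpa using hg 1
    have g2 : g ⟨2, by omega⟩ = c := by simpa using hg 2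
    have g3 : g ⟨3, by omega⟩ = d := by simpa using hg 3
    obtain ⟨w, hw⟩ := surj_pi π hm hπt g
    have key : ∀ u v : SchurCover m, π u = π v → u = v ∨ u = zz m * v := by
      intro u v huv
      rcases ker_pi π hm hπz hπt (u * v⁻¹) (by simp [huv]) with h | h
      · left; exact mul_inv_eq_one.mp h
      · right; exact mul_inv_eq_iff_eq_mul.mp h
    have hx' : π x = π (w * tt ⟨0, by omega⟩ * w⁻¹) := by
      rw [hx, map_mul, map_mul, map_inv, hw, hπt, ← g0, ← g1, Equiv.swap_apply_apply]
    have hy' : π y = π (w * tt ⟨2, by omega⟩ * w⁻¹) := by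
      rw [hy, map_mul, map_mul, map_inv, hw, hπt, ← g2, ← g3, Equiv.swap_apply_apply]
    have ha := tt_anti (m := m) ⟨0, by omega⟩ ⟨2, by omega⟩ (Or.inl (by simp))
    generalize (tt ⟨0, by omega⟩ : SchurCover m) = t0 at *
    generalize (tt ⟨2, by omega⟩ : SchurCover m) = t2 at *
    have hb : (w * t0 * w⁻¹) * (w * t2 * w⁻¹) = zz m * ((w * t2 * w⁻¹) * (w * t0 * w⁻¹)) := by
      have : (w * t0 * w⁻¹) * (w * t2 * w⁻¹) = w * (t0 * t2) * w⁻¹ := by group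
      rw [this, ha, ← mul_assoc w, ← zz_comm w]
      group
    generalize w * t0 * w⁻¹ = u at *
    generalize w * t2 * w⁻¹ = v at *
    have zl : ∀ r s : SchurCover m, r * (zz m * s) = zz m * (r * s) := by
      intro r s; rw [← mul_assoc, ← zz_comm, mul_assoc]
    rcases key _ _ hx' with rfl | rfl <;> rcases key _ _ hy' with rfl | rfl <;>
      simp only [mul_assoc, zl, hb]

end Final
end SchurAux

/-- Let `m ≥ 4`, let `π : S̃_m → S_m` be the homomorphism from Schur's double cover
sending the central element `z` to `1` and `t_i` to the transposition `(i, i+1)`.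
For `σ ∈ S_m` and a lift `x ∈ S̃_m` of `σ`, the elements `x` and `z·x` are NOT
conjugate in `S̃_m` if and only if either every part of the cycle partition of `σ`
is odd, or the parts of the cycle partition of `σ` are pairwise distinct and the
number of even parts is odd. -/
theorem schurCover_not_isConj_iff (m : ℕ) (hm : 4 ≤ m)
    (π : SchurCover m →* Equiv.Perm (Fin m))
    (hπz : π (PresentedGroup.of (none : Option (Fin (m - 1)))) = 1)
    (hπt : ∀ i : Fin (m - 1),
      π (PresentedGroup.of (some i)) =
        Equiv.swap ⟨(i : ℕ), by have := i.2; omega⟩ ⟨(i : ℕ) + 1, by have := i.2; omega⟩)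
    (σ : Equiv.Perm (Fin m)) (x : SchurCover m) (hx : π x = σ) :
    ¬ IsConj x (PresentedGroup.of (none : Option (Fin (m - 1))) * x) ↔
      ((∀ p ∈ σ.partition.parts, Odd p) ∨
        (σ.partition.parts.Nodup ∧
          Odd (Multiset.card (Multiset.filter (fun p => Even p) σ.partition.parts)))) := by
  subst hx
  exact (SchurAux.schurCover_cover π hm hπz hπt).main (SchurAux.z_ne_one m) x
end

section
/- Let m ≥ 1 with binary expansion m = Σ_i b_i 2^i (b_i ∈ {0,1}), and let σ ∈ S_m be a permutation whose order is a power of 2. Then σ satisfies [every part of its cycle partition is odd] or [the parts of its cycle partition are pairwise distinct and the number of even parts is odd] if and only if either σ = 1, or the number of indices i ≥ 1 with b_i = 1 is odd and the cycle partition of σ consists of exactly one part equal to 2^i for each index i with b_i = 1. Consequently, for each m there is at most one conjugacy class of nontrivial permutations of 2-power order satisfying one of these two conditions. -/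
/-- The condition on a permutation `σ` (on its cycle partition, fixed points counted as
parts equal to `1`): every part is odd, or the parts are pairwise distinct and the
number of even parts is odd. -/
def schurCond {m : ℕ} (σ : Equiv.Perm (Fin m)) : Prop :=
  (∀ p ∈ σ.partition.parts, Odd p) ∨
    (σ.partition.parts.Nodup ∧
      Odd (Multiset.card (Multiset.filter (fun p => Even p) σ.partition.parts)))

lemma parts_two_pow {m : ℕ} (σ : Equiv.Perm (Fin m)) (h : ∃ j : ℕ, orderOf σ = 2 ^ j) :
    ∀ p ∈ σ.partition.parts, ∃ i, p = 2 ^ i := by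
  obtain ⟨j, hj⟩ := h
  intro p hp
  rw [Equiv.Perm.parts_partition, Multiset.mem_add] at hp
  rcases hp with hp | hp
  · have h1 := Equiv.Perm.dvd_of_mem_cycleType hp
    rw [hj, Nat.dvd_prime_pow Nat.prime_two] at h1
    obtain ⟨k, -, hk⟩ := h1
    exact ⟨k, hk⟩
  · exact ⟨0, by simpa using Multiset.eq_of_mem_replicate hp⟩

lemma eq_one_of_odd {m : ℕ} (σ : Equiv.Perm (Fin m)) (h : ∃ j : ℕ, orderOf σ = 2 ^ j)
    (ho : ∀ p ∈ σ.partition.parts, Odd p) : σ = 1 := by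
  rw [← Equiv.Perm.cycleType_eq_zero, Multiset.eq_zero_iff_forall_notMem]
  intro p hp
  have h2 := Equiv.Perm.two_le_of_mem_cycleType hp
  have hp' : p ∈ σ.partition.parts := by
    rw [Equiv.Perm.parts_partition, Multiset.mem_add]; exact Or.inl hp
  obtain ⟨i, rfl⟩ := parts_two_pow σ h p hp'
  have h3 := ho _ hp'
  rcases i with _ | i
  · simp at h2
  · rw [pow_succ] at h3
    exact (Nat.not_odd_iff_even.2 (even_two.mul_left _)) h3

lemma filter_testBit_eq (m : ℕ) :
    ((Finset.range m).filter fun i => m.testBit i) = m.bitIndices.toFinset := by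
  ext i
  simp only [Finset.mem_filter, Finset.mem_range, List.mem_toFinset, Nat.mem_bitIndices,
    and_iff_right_iff_imp]
  intro h
  exact i.lt_two_pow_self.trans_le (Nat.two_pow_le_of_mem_bitIndices (Nat.mem_bitIndices.2 h))

lemma parts_eq_of_nodup {m : ℕ} (σ : Equiv.Perm (Fin m)) (h : ∃ j : ℕ, orderOf σ = 2 ^ j)
    (hn : σ.partition.parts.Nodup) :
    σ.partition.parts =
      (((Finset.range m).filter fun i => m.testBit i).val.map fun i => 2 ^ i) := by
  have hp := parts_two_pow σ h
  have hs : σ.partition.parts.sum = m := by simpa using σ.partition.parts_sum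
  generalize σ.partition.parts = P at *
  have hP : (P.map (Nat.log 2)).map (fun i => 2 ^ i) = P := by
    rw [Multiset.map_map]
    conv_rhs => rw [← Multiset.map_id P]
    apply Multiset.map_congr rfl
    intro p hpP
    obtain ⟨i, rfl⟩ := hp p hpP
    simp [Nat.log_pow]
  have hT : (P.map (Nat.log 2)).Nodup := by
    apply Multiset.Nodup.of_map (fun i => 2 ^ i)
    rw [hP]; exact hn
  let s : Finset ℕ := ⟨P.map (Nat.log 2), hT⟩
  have hsum : ∑ i ∈ s, 2 ^ i = m := by
    rw [← hs]; conv_rhs => rw [← hP]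
    rfl
  have hb := Finset.toFinset_bitIndices_sum_two_pow s
  rw [hsum] at hb
  rw [filter_testBit_eq, hb]
  exact hP.symm

lemma card_even (m : ℕ) : Multiset.card (Multiset.filter (fun p => Even p)
      (((Finset.range m).filter fun i => m.testBit i).val.map fun i => 2 ^ i)) =
    ((Finset.range m).filter fun i => 1 ≤ i ∧ m.testBit i).card := by
  rw [Multiset.filter_map, Multiset.card_map, Finset.card_def, Finset.filter_val,
    Finset.filter_val, Multiset.filter_filter]
  congr 1
  apply Multiset.filter_congr
  intro i _
  simp [Nat.even_pow, Nat.one_le_iff_ne_zero]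

lemma schur_iff {m : ℕ} (σ : Equiv.Perm (Fin m)) (h : ∃ j : ℕ, orderOf σ = 2 ^ j) :
    schurCond σ ↔
        σ = 1 ∨
          (Odd (((Finset.range m).filter fun i => 1 ≤ i ∧ m.testBit i).card) ∧
            σ.partition.parts =
              (((Finset.range m).filter fun i => m.testBit i).val.map fun i => 2 ^ i)) := by
  constructor
  · rintro (ho | ⟨hn, ho⟩)
    · exact Or.inl (eq_one_of_odd σ h ho)
    · have := parts_eq_of_nodup σ h hn
      rw [this, card_even] at ho
      exact Or.inr ⟨ho, this⟩
  · rintro (rfl | ⟨ho, he⟩)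
    · left
      intro p hp
      rw [Equiv.Perm.parts_partition, Multiset.mem_add] at hp
      rcases hp with hp | hp
      · simp at hp
      · rw [Multiset.eq_of_mem_replicate hp]; exact odd_one
    · right
      rw [he, card_even]
      exact ⟨(Finset.nodup _).map (Nat.pow_right_injective le_rfl), ho⟩

/-- Let `m ≥ 1` with binary expansion `m = Σ_i b_i 2^i`. A permutation `σ ∈ S_m` of
2-power order satisfies `schurCond` iff either `σ = 1`, or the number of indices
`i ≥ 1` with `b_i = 1` is odd and the cycle partition of `σ` consists of exactly one
part `2^i` for each index `i` with `b_i = 1`. Consequently there is at most one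
conjugacy class of nontrivial permutations of 2-power order satisfying `schurCond`. -/
theorem schurCond_two_power_iff (m : ℕ) (hm : 1 ≤ m) :
    (∀ σ : Equiv.Perm (Fin m), (∃ j : ℕ, orderOf σ = 2 ^ j) →
      (schurCond σ ↔
        σ = 1 ∨
          (Odd (((Finset.range m).filter fun i => 1 ≤ i ∧ m.testBit i).card) ∧
            σ.partition.parts =
              (((Finset.range m).filter fun i => m.testBit i).val.map fun i => 2 ^ i)))) ∧
    (∀ σ τ : Equiv.Perm (Fin m), (∃ j : ℕ, orderOf σ = 2 ^ j) → (∃ j : ℕ, orderOf τ = 2 ^ j) →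
      σ ≠ 1 → τ ≠ 1 → schurCond σ → schurCond τ → IsConj σ τ) := by
  refine ⟨fun σ h => schur_iff σ h, ?_⟩
  intro σ τ hσ hτ h1 h2 c1 c2
  have e1 := ((schur_iff σ hσ).1 c1).resolve_left h1
  have e2 := ((schur_iff τ hτ).1 c2).resolve_left h2
  rw [Equiv.Perm.partition_eq_of_isConj]
  exact Nat.Partition.ext (e1.2.trans e2.2.symm)
end

section
/- Let m ≥ 1. There exists a nontrivial permutation σ ∈ S_m of 2-power order such that [every part of its cycle partition is odd] or [the parts of its cycle partition are pairwise distinct and the number of even parts is odd] if and only if the binary expansion of ⌊m/2⌋ contains an odd number of ones, equivalently the number of indices i ≥ 1 with b_i = 1 in the binary expansion m = Σ_i b_i 2^i is odd. -/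
theorem schurAux_filter (m : ℕ) :
    ((Finset.range m).filter fun i => 1 ≤ i ∧ m.testBit i) =
      (m.bitIndices.toFinset).filter (fun i => 1 ≤ i) := by
  ext i
  simp only [Finset.mem_filter, Finset.mem_range, List.mem_toFinset, Nat.mem_bitIndices]
  constructor
  · rintro ⟨_, h1, h2⟩
    exact ⟨h2, h1⟩
  · rintro ⟨h2, h1⟩
    exact ⟨lt_of_lt_of_le Nat.lt_two_pow_self (Nat.ge_two_pow_of_testBit h2), h1, h2⟩

theorem schurAux_even (i : ℕ) : Even (2 ^ i) ↔ 1 ≤ i := by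
  rw [Nat.even_pow]
  simp
  omega

theorem schurAux_parts {m : ℕ} (P : Multiset ℕ) (hs : P.sum = m) (hn : P.Nodup)
    (hp : ∀ p ∈ P, ∃ i, p = 2 ^ i) : P = (m.bitIndices.toFinset).val.map (fun i => 2 ^ i) := by
  have hinj : Function.Injective (fun i : ℕ => 2 ^ i) := Nat.pow_right_injective le_rfl
  set T : Finset ℕ := P.toFinset.image (Nat.log 2) with hT
  have h1 : P = T.val.map (fun i => 2 ^ i) := by
    rw [Multiset.Nodup.ext hn (T.nodup.map hinj)]
    intro a
    simp only [Multiset.mem_map, Finset.mem_val, hT, Finset.mem_image, Multiset.mem_toFinset]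
    constructor
    · intro ha
      obtain ⟨i, rfl⟩ := hp a ha
      exact ⟨i, ⟨_, ha, by simp⟩, rfl⟩
    · rintro ⟨i, ⟨b, hb, rfl⟩, rfl⟩
      obtain ⟨i, rfl⟩ := hp b hb
      simpa using hb
  have h2 : ∑ i ∈ T, 2 ^ i = m := by
    rw [← hs, h1]
    rfl
  have h3 := Finset.toFinset_bitIndices_sum_two_pow T
  rw [h2] at h3
  rw [h3]
  exact h1

theorem exists_schurCond_iff (m : ℕ) (hm : 1 ≤ m) :
    (∃ σ : Equiv.Perm (Fin m), σ ≠ 1 ∧ (∃ j : ℕ, orderOf σ = 2 ^ j) ∧ schurCond σ) ↔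
      Odd (((Finset.range m).filter fun i => 1 ≤ i ∧ m.testBit i).card) := by
  have hinj : Function.Injective (fun i : ℕ => 2 ^ i) := Nat.pow_right_injective le_rfl
  rw [schurAux_filter]
  constructor
  · rintro ⟨σ, hσ, ⟨j, hj⟩, h⟩
    have hc : ∀ p ∈ σ.cycleType, ∃ i, p = 2 ^ i := by
      intro p hp
      have := Equiv.Perm.dvd_of_mem_cycleType hp
      rw [hj, Nat.dvd_prime_pow Nat.prime_two] at this
      obtain ⟨i, _, hi⟩ := this
      exact ⟨i, hi⟩
    rcases h with h | ⟨hn, ho⟩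
    · exfalso
      apply hσ
      rw [← Equiv.Perm.cycleType_eq_zero]
      refine Multiset.eq_zero_of_forall_notMem fun p hp => ?_
      have h2 := Equiv.Perm.two_le_of_mem_cycleType hp
      have h3 := h p (by rw [Equiv.Perm.parts_partition]; exact Multiset.mem_add.2 (Or.inl hp))
      obtain ⟨i, rfl⟩ := hc p hp
      rw [← Nat.not_even_iff_odd, schurAux_even] at h3
      have : i = 0 := by omega
      subst this
      simp at h2
    · have hp : ∀ p ∈ σ.partition.parts, ∃ i, p = 2 ^ i := by
        intro p hp
        rw [Equiv.Perm.parts_partition, Multiset.mem_add] at hp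
        rcases hp with hp | hp
        · exact hc p hp
        · exact ⟨0, by simpa using Multiset.eq_of_mem_replicate hp⟩
      have hs : σ.partition.parts.sum = m := by simpa using σ.partition.parts_sum
      rw [schurAux_parts _ hs hn hp, Multiset.filter_map, Multiset.card_map] at ho
      convert ho using 1
      rw [Finset.card_def, Finset.filter_val]
      congr 1
      apply Multiset.filter_congr
      intro i _
      simp [schurAux_even]
  · intro ho
    set S := m.bitIndices.toFinset with hS
    have hsum : ∑ i ∈ S, 2 ^ i = m := Finset.sum_toFinset_bitIndices_two_pow m
    set A := S.filter (fun i => 1 ≤ i) with hA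
    have hsplit : ∑ i ∈ A, 2 ^ i + ∑ i ∈ S.filter (fun i => ¬ 1 ≤ i), 2 ^ i = m := by
      rw [hA, Finset.sum_filter_add_sum_filter_not, hsum]
    have hle : ∑ i ∈ S.filter (fun i => ¬ 1 ≤ i), 2 ^ i ≤ 1 := by
      calc ∑ i ∈ S.filter (fun i => ¬ 1 ≤ i), 2 ^ i ≤ ∑ i ∈ ({0} : Finset ℕ), 2 ^ i := by
            apply Finset.sum_le_sum_of_subset
            intro i hi
            simp only [Finset.mem_filter] at hi
            simp
            omega
        _ = 1 := by simp
    have hms : (A.val.map (fun i => 2 ^ i)).sum = ∑ i ∈ A, 2 ^ i := rfl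
    have h2 : ∀ a ∈ A.val.map (fun i => 2 ^ i), 2 ≤ a ∧ Even a ∧ a ∣ 2 ^ m := by
      intro a ha
      obtain ⟨i, hi, rfl⟩ := Multiset.mem_map.1 ha
      have hi' : i ∈ S ∧ 1 ≤ i := Finset.mem_filter.1 hi
      refine ⟨?_, (schurAux_even i).2 hi'.2, ?_⟩
      · calc 2 = 2 ^ 1 := rfl
          _ ≤ 2 ^ i := Nat.pow_le_pow_right (by norm_num) hi'.2
      · apply pow_dvd_pow
        have : m.testBit i := by simpa [hS] using hi'.1
        exact (lt_of_lt_of_le Nat.lt_two_pow_self (Nat.ge_two_pow_of_testBit this)).le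
    obtain ⟨σ, hσ⟩ := (Equiv.Perm.exists_with_cycleType_iff (Fin m)
      (m := A.val.map (fun i => 2 ^ i))).2
      ⟨by rw [hms, Fintype.card_fin]; omega, fun a ha => (h2 a ha).1⟩
    refine ⟨σ, ?_, ?_, Or.inr ⟨?_, ?_⟩⟩
    · rintro rfl
      rw [Equiv.Perm.cycleType_one] at hσ
      have := congrArg Multiset.card hσ
      rw [Multiset.card_map, Multiset.card_zero] at this
      change 0 = A.card at this
      rw [← this] at ho
      simp at ho
    · have : orderOf σ ∣ 2 ^ m := by
        rw [← Equiv.Perm.lcm_cycleType, hσ]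
        exact Multiset.lcm_dvd.2 fun a ha => (h2 a ha).2.2
      obtain ⟨j, _, hj⟩ := (Nat.dvd_prime_pow Nat.prime_two).1 this
      exact ⟨j, hj⟩
    · rw [Equiv.Perm.parts_partition, ← Equiv.Perm.sum_cycleType, hσ, hms, Fintype.card_fin,
        Multiset.nodup_add]
      refine ⟨A.nodup.map hinj, ?_, ?_⟩
      · rw [Multiset.nodup_iff_count_le_one]
        intro a
        rw [Multiset.count_replicate]
        split_ifs <;> omega
      · rw [Multiset.disjoint_left]
        intro a ha ha'
        have := (h2 a ha).1
        have := Multiset.eq_of_mem_replicate ha'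
        omega
    · rw [Equiv.Perm.parts_partition, hσ, Multiset.filter_add,
        Multiset.filter_eq_self.2 fun a ha => (h2 a ha).2.1,
        Multiset.filter_eq_nil.2 fun a ha => by
          rw [Multiset.eq_of_mem_replicate ha]; decide, add_zero, Multiset.card_map]
      exact ho
end

section
/- Let m ≥ 1 with binary expansion m = Σ_i b_i 2^i, let s = |{i ≥ 0 : b_i = 1}| be the number of ones in the binary expansion of m, and let d be an integer. Consider the sum S := Σ_{[σ]} d^{c(σ)} taken over all conjugacy classes [σ] of permutations σ ∈ S_m of 2-power order such that [every part of the cycle partition of σ is odd] or [the parts of the cycle partition of σ are pairwise distinct and the number of even parts is odd], where c(σ) is the number of parts of the cycle partition of σ. Then S = d^m + d^s if the number of indices i ≥ 1 with b_i = 1 is odd, and S = d^m otherwise. -/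
def binIdx (m : ℕ) : Finset ℕ := (Finset.range m).filter fun i => m.testBit i

def binParts (m : ℕ) : Multiset ℕ := (binIdx m).val.map (fun i => 2 ^ i)

theorem binIdx_eq (m : ℕ) : binIdx m = m.bitIndices.toFinset := by
  ext i
  simp only [binIdx, Finset.mem_filter, Finset.mem_range, List.mem_toFinset, Nat.mem_bitIndices,
    and_iff_right_iff_imp]
  intro h
  exact lt_of_lt_of_le Nat.lt_two_pow_self (Nat.ge_two_pow_of_testBit h)

theorem binParts_sum (m : ℕ) : (binParts m).sum = m := by
  have := Finset.sum_toFinset_bitIndices_two_pow m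
  rw [← binIdx_eq] at this
  exact this

theorem two_pow_inj : Function.Injective (fun i : ℕ => 2 ^ i) :=
  Nat.pow_right_injective le_rfl

theorem binParts_nodup (m : ℕ) : (binParts m).Nodup :=
  Multiset.Nodup.map two_pow_inj (binIdx m).nodup

theorem eq_binParts {m : ℕ} (s : Multiset ℕ) (hs : s.sum = m) (hn : s.Nodup)
    (h2 : ∀ p ∈ s, ∃ k : ℕ, p = 2 ^ k) : s = binParts m := by
  have h : s = (s.map (Nat.log 2)).map (fun i => 2 ^ i) := by
    rw [Multiset.map_map]
    conv_lhs => rw [← Multiset.map_id s]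
    apply Multiset.map_congr rfl
    intro x hx
    obtain ⟨k, rfl⟩ := h2 x hx
    simp
  have hn' : (s.map (Nat.log 2)).Nodup := by
    rw [h] at hn
    exact hn.of_map
  have h3 : ∑ i ∈ (⟨s.map (Nat.log 2), hn'⟩ : Finset ℕ), 2 ^ i = m := by
    rw [← hs]
    conv_rhs => rw [h]
    rfl
  have h4 := Finset.toFinset_bitIndices_sum_two_pow (⟨s.map (Nat.log 2), hn'⟩ : Finset ℕ)
  rw [h3, ← binIdx_eq] at h4
  rw [h, binParts, h4]

theorem card_even_binParts (m : ℕ) :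
    Multiset.card (Multiset.filter (fun p => Even p) (binParts m)) =
      ((Finset.range m).filter fun i => 1 ≤ i ∧ m.testBit i).card := by
  rw [binParts, Multiset.filter_map, Multiset.card_map]
  have : ((Finset.range m).filter fun i => 1 ≤ i ∧ m.testBit i)
      = (binIdx m).filter (fun i => Even (2 ^ i)) := by
    ext i
    simp [binIdx, Nat.even_pow]
    constructor
    · rintro ⟨a, b, c⟩; exact ⟨⟨a, c⟩, by omega⟩
    · rintro ⟨⟨a, b⟩, c⟩; exact ⟨a, by omega, b⟩
  rw [this]
  rfl

theorem two_pow_order_iff {m : ℕ} (σ : Equiv.Perm (Fin m)) :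
    (∃ j : ℕ, orderOf σ = 2 ^ j) ↔ ∀ p ∈ σ.partition.parts, ∃ k : ℕ, p = 2 ^ k := by
  rw [Equiv.Perm.parts_partition]
  constructor
  · rintro ⟨j, hj⟩ p hp
    rcases Multiset.mem_add.1 hp with hp | hp
    · have : p ∣ 2 ^ j := hj ▸ Equiv.Perm.dvd_of_mem_cycleType hp
      obtain ⟨k, -, hk⟩ := (Nat.dvd_prime_pow Nat.prime_two).1 this
      exact ⟨k, hk⟩
    · exact ⟨0, by simpa using Multiset.eq_of_mem_replicate hp⟩
  · intro h
    have key : ∀ s : Multiset ℕ, (∀ p ∈ s, ∃ k : ℕ, p = 2 ^ k) → ∃ j : ℕ, s.lcm = 2 ^ j := by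
      intro s
      induction s using Multiset.induction with
      | empty => intro _; exact ⟨0, by simp⟩
      | cons a s ih =>
        intro h
        obtain ⟨j, hj⟩ := ih (fun p hp => h p (Multiset.mem_cons_of_mem hp))
        obtain ⟨k, rfl⟩ := h a (Multiset.mem_cons_self _ _)
        have : Multiset.lcm ((2 ^ k) ::ₘ s) ∣ 2 ^ (max k j) := by
          rw [Multiset.lcm_cons, hj]
          exact lcm_dvd (pow_dvd_pow _ (le_max_left _ _)) (pow_dvd_pow _ (le_max_right _ _))
        obtain ⟨l, -, hl⟩ := (Nat.dvd_prime_pow Nat.prime_two).1 this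
        exact ⟨l, hl⟩
    rw [← Equiv.Perm.lcm_cycleType]
    exact key _ (fun p hp => h p (Multiset.mem_add.2 (Or.inl hp)))

theorem parts_sum' {m : ℕ} (σ : Equiv.Perm (Fin m)) : σ.partition.parts.sum = m := by
  rw [σ.partition.parts_sum, Fintype.card_fin]

theorem cond_iff {m : ℕ} (σ : Equiv.Perm (Fin m)) :
    ((∃ j : ℕ, orderOf σ = 2 ^ j) ∧ schurCond σ) ↔
      (σ.partition.parts = Multiset.replicate m 1 ∨
        (σ.partition.parts = binParts m ∧
          Odd (((Finset.range m).filter fun i => 1 ≤ i ∧ m.testBit i).card))) := by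
  rw [two_pow_order_iff, schurCond]
  have hs := parts_sum' σ
  generalize σ.partition.parts = s at *
  constructor
  · rintro ⟨h2, h | ⟨hn, ho⟩⟩
    · left
      have h1 : ∀ p ∈ s, p = 1 := by
        intro p hp
        obtain ⟨k, rfl⟩ := h2 p hp
        have := h _ hp
        rcases k with _ | k
        · simp
        · exact absurd this (by simp [Nat.even_pow])
      have := Multiset.eq_replicate_card.2 h1
      rw [this] at hs
      simp at hs
      rw [this, hs]
    · right
      have := eq_binParts s hs hn h2
      rw [← card_even_binParts, ← this]
      exact ⟨rfl, ho⟩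
  · rintro (rfl | ⟨rfl, ho⟩)
    · have h : ∀ p ∈ Multiset.replicate m 1, p = 1 := fun p hp => Multiset.eq_of_mem_replicate hp
      refine ⟨fun p hp => ⟨0, by simpa using h p hp⟩, Or.inl fun p hp => ?_⟩
      rw [h p hp]; exact odd_one
    · refine ⟨fun p hp => ?_, Or.inr ⟨binParts_nodup m, ?_⟩⟩
      · obtain ⟨k, -, rfl⟩ := Multiset.mem_map.1 hp
        exact ⟨k, rfl⟩
      · rw [card_even_binParts]; exact ho

theorem exists_perm_parts {m : ℕ} (s : Multiset ℕ) (hs : s.sum = m) (hp : ∀ p ∈ s, 0 < p) :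
    ∃ σ : Equiv.Perm (Fin m), σ.partition.parts = s := by
  have hsplit : s = s.filter (fun n => 2 ≤ n) +
      Multiset.replicate (Multiset.card (s.filter (fun n => ¬ 2 ≤ n))) 1 := by
    conv_lhs => rw [← Multiset.filter_add_not (fun n => 2 ≤ n) s]
    congr 1
    apply Multiset.eq_replicate_card.2
    intro b hb
    have := Multiset.mem_filter.1 hb
    have := hp b this.1
    omega
  have hsum : (s.filter (fun n => 2 ≤ n)).sum
      + Multiset.card (s.filter (fun n => ¬ 2 ≤ n)) = m := by
    conv_rhs => rw [← hs, hsplit]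
    simp
  obtain ⟨σ, hσ⟩ := (Equiv.Perm.exists_with_cycleType_iff (Fin m)
    (m := s.filter (fun n => 2 ≤ n))).2 ⟨by rw [Fintype.card_fin]; omega,
      fun a ha => (Multiset.mem_filter.1 ha).2⟩
  refine ⟨σ, ?_⟩
  rw [Equiv.Perm.parts_partition, ← Equiv.Perm.sum_cycleType, hσ, Fintype.card_fin]
  conv_rhs => rw [hsplit]
  congr 2
  omega

theorem exists_class {m : ℕ} (s : Multiset ℕ) (hs : s.sum = m) (hp : ∀ p ∈ s, 0 < p) :
    ∃ c : ConjClasses (Equiv.Perm (Fin m)),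
      ∀ c', (Quotient.out c').partition.parts = s ↔ c' = c := by
  obtain ⟨σ, hσ⟩ := exists_perm_parts s hs hp
  refine ⟨ConjClasses.mk σ, fun c' => ?_⟩
  have h : ConjClasses.mk (Quotient.out c') = c' := Quotient.out_eq c'
  conv_rhs => rw [← h]
  rw [ConjClasses.mk_eq_mk_iff_isConj, Equiv.Perm.partition_eq_of_isConj, Nat.Partition.ext_iff,
    hσ]


/-- Let `m ≥ 1` with binary expansion `m = Σ_i b_i 2^i`, let `s` be the number of ones
in the binary expansion of `m`, and let `d : ℤ`. The sum of `d^{c(σ)}` over all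
conjugacy classes of permutations `σ ∈ S_m` of 2-power order satisfying `schurCond`
(where `c(σ)` is the number of parts of the cycle partition of `σ`) equals
`d^m + d^s` if the number of indices `i ≥ 1` with `b_i = 1` is odd, and `d^m`
otherwise. -/
theorem sum_over_schurCond_classes (m : ℕ) (hm : 1 ≤ m) (d : ℤ) :
    (∑ᶠ (c : ConjClasses (Equiv.Perm (Fin m)))
        (_ : (∃ j : ℕ, orderOf (Quotient.out c) = 2 ^ j) ∧ schurCond (Quotient.out c)),
        d ^ Multiset.card (Quotient.out c).partition.parts) =
      if Odd (((Finset.range m).filter fun i => 1 ≤ i ∧ m.testBit i).card) then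
        d ^ m + d ^ (((Finset.range m).filter fun i => m.testBit i).card)
      else d ^ m := by
  obtain ⟨c₀, h₀⟩ := exists_class (m := m) (Multiset.replicate m 1) (by simp)
    (fun p hp => by rw [Multiset.eq_of_mem_replicate hp]; exact one_pos)
  obtain ⟨c₁, h₁⟩ := exists_class (m := m) (binParts m) (binParts_sum m)
    (fun p hp => by obtain ⟨k, -, rfl⟩ := Multiset.mem_map.1 hp; positivity)
  simp_rw [cond_iff, h₀, h₁]
  have e₀ := (h₀ c₀).2 rfl
  have e₁ := (h₁ c₁).2 rfl
  split_ifs with ho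
  · have hne : c₀ ≠ c₁ := by
      rintro rfl
      rw [← card_even_binParts, ← e₁, e₀] at ho
      rw [Multiset.filter_eq_nil.2] at ho
      · simp at ho
      · intro a ha
        rw [Multiset.eq_of_mem_replicate ha]; simp
    have hP : ∀ c, (c = c₀ ∨ (c = c₁ ∧ Odd (((Finset.range m).filter
        fun i => 1 ≤ i ∧ m.testBit i).card))) ↔ c ∈ ({c₀, c₁} : Set _) := by
      intro c; simp [ho]
    simp_rw [hP]
    rw [finsum_mem_pair hne, e₀, e₁, Multiset.card_replicate]
    rw [binParts, Multiset.card_map]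
    rfl
  · have hP : ∀ c, (c = c₀ ∨ (c = c₁ ∧ Odd (((Finset.range m).filter
        fun i => 1 ≤ i ∧ m.testBit i).card))) ↔ c ∈ ({c₀} : Set _) := by
      intro c; simp [ho]
    simp_rw [hP]
    rw [finsum_mem_singleton, e₀, Multiset.card_replicate]
end

section
/- Let p be a prime, let K be an algebraic closure of the field with p elements, let W = WittVector p K be the ring of p-typical Witt vectors of K, and let R = MvPowerSeries (Fin r) W be the multivariate power series ring over W in r variables (r ∈ ℕ). Then: (a) if p is odd, every unit u of R satisfying u^{p^j} = 1 for some j ∈ ℕ equals 1; (b) if p = 2, every unit u of R satisfying u^{2^j} = 1 for some j ∈ ℕ equals 1 or −1. In other words, the p-power torsion subgroup of R^× is trivial for p odd and equals {±1} for p = 2. -/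
theorem geom_ne_zero_aux {D : Type*} [CommRing D] [IsDomain D] (p : ℕ) (hp : p.Prime)
    (hP : Prime (p : D)) (hodd : Odd p) (c : D)
    (h : ∑ i ∈ Finset.range p, c ^ i = 0) : False := by
  have h1 : c ^ p = 1 := by
    have := geom_sum_mul c p
    rw [h, zero_mul] at this
    exact (sub_eq_zero.mp this.symm)
  obtain ⟨s, hs⟩ := exists_add_pow_prime_eq hp (c - 1) 1
  rw [sub_add_cancel, h1, one_pow] at hs
  have h2 : (p : D) ∣ (c - 1) ^ p := ⟨-((c - 1) * 1 * s), by linear_combination -hs⟩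
  obtain ⟨w, hw⟩ := hP.dvd_of_dvd_pow h2
  have h3 := odd_sq_dvd_geom_sum₂_sub (a := (1 : D)) (b := w) hodd
  have h4 : (1 : D) + p * w = c := by linear_combination -hw
  simp only [h4, one_pow, mul_one, h, zero_sub, dvd_neg] at h3
  obtain ⟨t, ht⟩ := h3
  apply hP.not_isUnit
  refine IsUnit.of_mul_eq_one t (mul_left_cancel₀ hP.ne_zero ?_)
  linear_combination -ht

theorem sq_ne_neg_one_aux {D : Type*} [CommRing D] [IsDomain D]
    (hP : Prime (2 : D)) (c : D) (h : c ^ 2 = -1) : False := by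
  have h2 : (2 : D) ∣ (c - 1) ^ 2 := ⟨-c, by linear_combination h⟩
  obtain ⟨w, hw⟩ := hP.dvd_of_dvd_pow h2
  apply hP.not_isUnit
  refine IsUnit.of_mul_eq_one (-(w + w ^ 2)) (mul_left_cancel₀ hP.ne_zero ?_)
  obtain rfl : c = 1 + 2 * w := by linear_combination hw
  linear_combination -h

/-- Let `p` be a prime, `K` an algebraic closure of the field with `p` elements,
`W = WittVector p K`, and `R = MvPowerSeries (Fin r) W`. Then: (a) if `p` is odd,
every unit `u` of `R` with `u^{p^j} = 1` for some `j` equals `1`; (b) if `p = 2`,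
every unit `u` of `R` with `u^{2^j} = 1` for some `j` equals `1` or `-1`. -/
theorem pPowerTorsion_units_wittVector_powerSeries (p : ℕ) [hp : Fact p.Prime] (r : ℕ) :
    (Odd p →
      ∀ u : (MvPowerSeries (Fin r) (WittVector p (AlgebraicClosure (ZMod p))))ˣ,
        (∃ j : ℕ, u ^ (p ^ j) = 1) → u = 1) ∧
    (p = 2 →
      ∀ u : (MvPowerSeries (Fin r) (WittVector p (AlgebraicClosure (ZMod p))))ˣ,
        (∃ j : ℕ, u ^ (2 ^ j) = 1) → u = 1 ∨ u = -1) := by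
  have hP : Prime ((p : ℕ) : WittVector p (AlgebraicClosure (ZMod p))) :=
    (WittVector.irreducible p).prime
  constructor
  · rintro hodd u ⟨j, hj⟩
    induction j with
    | zero => simpa using hj
    | succ j ih =>
      apply ih
      rw [pow_succ, pow_mul] at hj
      generalize u ^ p ^ j = v at hj
      by_contra hne
      have hv : (v : MvPowerSeries (Fin r) (WittVector p (AlgebraicClosure (ZMod p)))) ^ p = 1 := by
        rw [← Units.val_pow_eq_pow_val, hj, Units.val_one]
      have h0 := geom_sum_mul
        (v : MvPowerSeries (Fin r) (WittVector p (AlgebraicClosure (ZMod p)))) p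
      rw [hv, sub_self] at h0
      rcases mul_eq_zero.mp h0 with h0 | h0
      · refine geom_ne_zero_aux p hp.out hP hodd (MvPowerSeries.constantCoeff v.val) ?_
        have := congrArg MvPowerSeries.constantCoeff h0
        simpa using this
      · exact hne (Units.ext (by simpa using sub_eq_zero.mp h0))
  · rintro hp2 u ⟨j, hj⟩
    have hP2 : Prime (2 : WittVector p (AlgebraicClosure (ZMod p))) := by
      have h := hP
      have e : ((p : ℕ) : WittVector p (AlgebraicClosure (ZMod p))) = 2 := by
        rw [← Nat.cast_two]
        exact congrArg Nat.cast hp2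
      rwa [e] at h
    have key : ∀ v : (MvPowerSeries (Fin r) (WittVector p (AlgebraicClosure (ZMod p))))ˣ,
        v ^ 2 = 1 → v = 1 ∨ v = -1 := by
      intro v hv
      have hv' := congrArg Units.val hv
      rw [Units.val_pow_eq_pow_val, Units.val_one] at hv'
      rcases sq_eq_one_iff.mp hv' with h | h
      · exact Or.inl (Units.ext (by simpa using h))
      · exact Or.inr (Units.ext (by simpa using h))
    induction j with
    | zero => left; simpa using hj
    | succ j ih =>
      rw [pow_succ, pow_mul] at hj
      rcases key _ hj with h | h
      · exact ih h
      · cases j with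
        | zero => right; simpa using h
        | succ j =>
          exfalso
          rw [pow_succ, pow_mul] at h
          generalize u ^ 2 ^ j = v at h
          have hv := congrArg Units.val h
          rw [Units.val_pow_eq_pow_val, Units.val_neg, Units.val_one] at hv
          refine sq_ne_neg_one_aux hP2 (MvPowerSeries.constantCoeff v.val) ?_
          rw [← map_pow, hv, map_neg, map_one]
end
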